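/- arXiv:1910.08360 — 2 statements merged into one kernel-verified Lean document; each statement's English description precedes it below -/
import Mathlib

section
/- Let λ, a, s be real numbers with λ ≥ √2 and a ≥ s > 0. Then a + (λ−1)·s + ⌈(a−s)/((λ/2)·s)⌉·s ≤ (1 + 2/λ)·a + (λ − 2/λ)·s ≤ (1+λ)·a, where ⌈·⌉ denotes the ceiling function. -/
/-- The key per-family inequality in the analysis of the `Transform` algorithm:
`a` is the contribution of a family (including its one-time setup) to the completion
time of an operation, `s` is the setup time of that family and `lam` is the pull
factor. -/
theorem transform_key_inequality (lam a s : ℝ)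
    (hlam : Real.sqrt 2 ≤ lam) (hs : 0 < s) (has : s ≤ a) :
    a + (lam - 1) * s + (⌈(a - s) / ((lam / 2) * s)⌉ : ℝ) * s ≤
        (1 + 2 / lam) * a + (lam - 2 / lam) * s ∧
      (1 + 2 / lam) * a + (lam - 2 / lam) * s ≤ (1 + lam) * a := by
  have hpos : 0 < lam := (Real.sqrt_pos.mpr two_pos).trans_le hlam
  have hsq : 2 ≤ lam ^ 2 := (Real.sqrt_le_left hpos.le).mp hlam
  constructor
  · have hceil : (⌈(a - s) / ((lam / 2) * s)⌉ : ℝ) * s ≤ ((a - s) / ((lam / 2) * s) + 1) * s :=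
      mul_le_mul_of_nonneg_right (Int.ceil_lt_add_one _).le hs.le
    have hdiv : ((a - s) / ((lam / 2) * s) + 1) * s = 2 / lam * (a - s) + s := by
      field_simp
    linarith
  · have hle : 2 / lam ≤ lam := by
      rw [div_le_iff₀ hpos]
      linarith
    linarith [mul_nonneg (sub_nonneg.mpr hle) (sub_nonneg.mpr has)]
end

section
/- Let P, W, p_i, w_i, p_k, w_k be nonnegative real numbers with p_i·w_k < p_k·w_i. Define Δ_1 = −W·p_k + P·w_k − w_i·p_k + w_k·p_i and Δ_2 = −(−W·p_i + P·w_i) − w_i·p_k + w_k·p_i. Then Δ_1 < 0 or Δ_2 < 0. -/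
/-- The exchange inequality used to establish the generalized weighted SPT-order:
`pi, wi` and `pk, wk` are the processing time and weight of two jobs `j_i` and `j_k`
with ratio `p_i/w_i < p_k/w_k` (equivalently `p_i·w_k < p_k·w_i`), and `P` and `W`
are the total processing time and total weight of the operations scheduled between
them.  `Δ₁` is the change of the total weighted completion time caused by moving
`j_k` directly behind `j_i`, and `Δ₂` the change caused by moving `j_i` directly
before `j_k`; at least one of the two moves strictly decreases the objective. -/
theorem exchange_inequality (P W pi wi pk wk : ℝ)
    (hP : 0 ≤ P) (hW : 0 ≤ W) (hpi : 0 ≤ pi) (hwi : 0 ≤ wi) (hpk : 0 ≤ pk)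
    (hwk : 0 ≤ wk) (hratio : pi * wk < pk * wi) :
    -W * pk + P * wk - wi * pk + wk * pi < 0 ∨
      -(-W * pi + P * wi) - wi * pk + wk * pi < 0 := by
  have hwi' : 0 < wi :=
    pos_of_mul_pos_right ((mul_nonneg hpi hwk).trans_lt hratio) hpk
  by_contra! h
  obtain ⟨h₁, h₂⟩ := h
  have ha : 0 < P * wk - W * pk := by linarith
  have hb : 0 ≤ W * pi - P * wi := by linarith
  have hsum : wi * (P * wk - W * pk) + wk * (W * pi - P * wi)
      = -(W * (pk * wi - pi * wk)) := by ring
  linarith [mul_pos hwi' ha, mul_nonneg hwk hb, mul_nonneg hW (sub_pos.2 hratio).le]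
end
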